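/- arXiv:1605.09614 — 7 statements merged into one kernel-verified Lean document; each statement's English description precedes it below -/
import Mathlib

section
/- For every v ∈ S₀, the function Tv again belongs to S₀; that is, Tv(x) ≤ x + b̄ for x ≥ 0, Tv(x) = 0 for x < 0, Tv is nonnegative, and Tv is nondecreasing and continuous on [0,∞). -/
open MeasureTheory Set Filter Topology

noncomputable section

/-- The constant `b̄ = β ∫ z⁺ ν(dz) / (1-β)`. -/
def bbar (ν : Measure ℝ) (β : ℝ) : ℝ := β * (∫ z, max z 0 ∂ν) / (1 - β)

/-- The dynamic programming operator `T`. -/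
def Tdiv (ν : Measure ℝ) (β γ : ℝ) (v : ℝ → ℝ) (x : ℝ) : ℝ :=
  if 0 ≤ x then
    sSup ((fun a => a - (β / γ) * Real.log
      ((∫ z in Ici (a - x), Real.exp (-(γ * v (x - a + z))) ∂ν)
        + (ν (Iio (a - x))).toReal)) '' Icc 0 x)
  else 0

/-- Membership in the set `S₀`. -/
def memS0 (ν : Measure ℝ) (β : ℝ) (v : ℝ → ℝ) : Prop :=
  (∀ x, 0 ≤ v x) ∧ (∀ x, 0 ≤ x → v x ≤ x + bbar ν β) ∧ (∀ x, x < 0 → v x = 0)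
    ∧ MonotoneOn v (Ici 0) ∧ ContinuousOn v (Ici 0)

/-- Membership in the set `S`. -/
def memS (ν : Measure ℝ) (β : ℝ) (v : ℝ → ℝ) : Prop :=
  (∀ x, 0 ≤ v x) ∧ (∀ x, 0 ≤ x → x ≤ v x ∧ v x ≤ x + bbar ν β) ∧ (∀ x, x < 0 → v x = 0)
    ∧ MonotoneOn v (Ici 0) ∧ ContinuousOn v (Ici 0)

/-- A decision rule. -/
def DecisionRule (α : ℝ → ℝ) : Prop :=
  Measurable α ∧ (∀ x, 0 ≤ x → α x ∈ Icc 0 x) ∧ (∀ x, x < 0 → α x = 0)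

/-- The operator `L_α` associated with a decision rule `α`. -/
def Ldiv (ν : Measure ℝ) (β γ : ℝ) (α : ℝ → ℝ) (v : ℝ → ℝ) (x : ℝ) : ℝ :=
  if 0 ≤ x then
    α x - (β / γ) * Real.log
      ((∫ z in Ici (α x - x), Real.exp (-(γ * v (x - α x + z))) ∂ν)
        + (ν (Iio (α x - x))).toReal)
  else 0

/-- The function `Γ` associated with a value function `J`. -/
def Gam (ν : Measure ℝ) (β γ : ℝ) (J : ℝ → ℝ) (x : ℝ) : ℝ :=
  -(β / γ) * Real.log
    ((∫ z in Ici (-x), Real.exp (-(γ * J (x + z))) ∂ν) + (ν (Iio (-x))).toReal)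

end

/-- The certainty-equivalent continuation value `-(β / γ) log ∫ exp (-γ v(y + z)) ν(dz)`. -/
noncomputable def contValue (ν : Measure ℝ) (β γ : ℝ) (v : ℝ → ℝ) (y : ℝ) : ℝ :=
  -(β / γ) * Real.log (∫ z, Real.exp (-(γ * v (y + z))) ∂ν)

theorem memS0.monotone {ν : Measure ℝ} {β : ℝ} {v : ℝ → ℝ} (hv : memS0 ν β v) :
    Monotone v := by
  obtain ⟨h0, -, hn, hm, -⟩ := hv
  intro x y hxy
  rcases lt_or_ge x 0 with hx | hx
  · rw [hn x hx]
    exact h0 y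
  · exact hm hx (hx.trans hxy) hxy

theorem memS0.continuousAt {ν : Measure ℝ} {β : ℝ} {v : ℝ → ℝ} (hv : memS0 ν β v)
    {x : ℝ} (hx : x ≠ 0) : ContinuousAt v x := by
  obtain ⟨-, -, hn, -, hc⟩ := hv
  rcases lt_or_gt_of_ne hx with hx | hx
  · refine (continuousAt_const (y := (0 : ℝ))).congr ?_
    filter_upwards [Iio_mem_nhds hx] with y hy using (hn y hy).symm
  · exact hc.continuousAt (Ici_mem_nhds hx)

theorem memS0.integrable_exp {ν : Measure ℝ} [IsProbabilityMeasure ν] {β γ : ℝ} (hγ : 0 < γ)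
    {v : ℝ → ℝ} (hv : memS0 ν β v) (y : ℝ) :
    Integrable (fun z => Real.exp (-(γ * v (y + z)))) ν := by
  have hmeas := hv.monotone.measurable
  refine Integrable.of_bound (C := 1) (Measurable.aestronglyMeasurable (by fun_prop)) (ae_of_all _ fun z => ?_)
  rw [Real.norm_eq_abs, Real.abs_exp, Real.exp_le_one_iff, neg_nonpos]
  exact mul_nonneg hγ.le (hv.1 _)

theorem memS0.integral_Ici_add_measure_Iio {ν : Measure ℝ} [IsProbabilityMeasure ν] {β γ : ℝ}
    (hγ : 0 < γ) {v : ℝ → ℝ} (hv : memS0 ν β v) (y : ℝ) :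
    (∫ z in Ici (-y), Real.exp (-(γ * v (y + z))) ∂ν) + (ν (Iio (-y))).toReal
      = ∫ z, Real.exp (-(γ * v (y + z))) ∂ν := by
  rw [← integral_add_compl (s := Ici (-y)) measurableSet_Ici (hv.integrable_exp hγ y), compl_Ici]
  congr 1
  have : EqOn (fun z => Real.exp (-(γ * v (y + z)))) (fun _ => 1) (Iio (-y)) := fun z hz => by
    have : v (y + z) = 0 := hv.2.2.1 _ (by linarith [mem_Iio.1 hz])
    simp [this]
  rw [setIntegral_congr_fun measurableSet_Iio this]
  simp [Measure.real]

theorem memS0.integral_exp_pos {ν : Measure ℝ} [IsProbabilityMeasure ν] {β γ : ℝ} (hγ : 0 < γ)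
    {v : ℝ → ℝ} (hv : memS0 ν β v) (y : ℝ) :
    0 < ∫ z, Real.exp (-(γ * v (y + z))) ∂ν :=
  MeasureTheory.integral_exp_pos (hv.integrable_exp hγ y)

theorem memS0.monotone_contValue {ν : Measure ℝ} [IsProbabilityMeasure ν] {β γ : ℝ} (hβ : 0 < β)
    (hγ : 0 < γ) {v : ℝ → ℝ} (hv : memS0 ν β v) : Monotone (contValue ν β γ v) := by
  intro x y hxy
  have h : Real.log (∫ z, Real.exp (-(γ * v (y + z))) ∂ν)
      ≤ Real.log (∫ z, Real.exp (-(γ * v (x + z))) ∂ν) := by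
    refine Real.log_le_log (hv.integral_exp_pos hγ y)
      (integral_mono (hv.integrable_exp hγ y) (hv.integrable_exp hγ x) fun z => ?_)
    have := hv.monotone (add_le_add_left hxy z)
    dsimp only
    gcongr
  simp only [contValue, neg_mul]
  have := mul_le_mul_of_nonneg_left h (div_pos hβ hγ).le
  linarith

theorem memS0.contValue_nonneg {ν : Measure ℝ} [IsProbabilityMeasure ν] {β γ : ℝ} (hβ : 0 < β)
    (hγ : 0 < γ) {v : ℝ → ℝ} (hv : memS0 ν β v) (y : ℝ) : 0 ≤ contValue ν β γ v y := by
  have h : ∫ z, Real.exp (-(γ * v (y + z))) ∂ν ≤ ∫ _, (1 : ℝ) ∂ν := by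
    refine integral_mono (hv.integrable_exp hγ y) (integrable_const _) fun z => ?_
    exact Real.exp_le_one_iff.2 (neg_nonpos.2 (mul_nonneg hγ.le (hv.1 _)))
  rw [integral_const, probReal_univ, one_smul] at h
  exact mul_nonneg_of_nonpos_of_nonpos (neg_nonpos.2 (div_pos hβ hγ).le)
    (Real.log_nonpos (hv.integral_exp_pos hγ y).le h)

theorem memS0.continuous_contValue {ν : Measure ℝ} [IsProbabilityMeasure ν] [NullSingletonClass ν]
    {β γ : ℝ} (hγ : 0 < γ) {v : ℝ → ℝ} (hv : memS0 ν β v) :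
    Continuous (contValue ν β γ v) := by
  have h : Continuous fun y => ∫ z, Real.exp (-(γ * v (y + z))) ∂ν := by
    rw [continuous_iff_continuousAt]
    intro y
    refine continuousAt_of_dominated (bound := fun _ => 1)
      (Eventually.of_forall fun x => (hv.integrable_exp hγ x).aestronglyMeasurable)
      (Eventually.of_forall fun x => ae_of_all _ fun z => ?_) (integrable_const _) ?_
    · rw [Real.norm_eq_abs, Real.abs_exp, Real.exp_le_one_iff, neg_nonpos]
      exact mul_nonneg hγ.le (hv.1 _)
    · have : ∀ᵐ z ∂ν, z ≠ -y := by simp [ae_iff]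
      filter_upwards [this] with z hz
      have hvc : ContinuousAt v (y + z) :=
        hv.continuousAt fun h => hz (by linarith)
      have : ContinuousAt (fun x => v (x + z)) y :=
        ContinuousAt.comp (f := fun x => x + z) hvc (by fun_prop)
      fun_prop
  exact continuous_const.mul (h.log fun y => (hv.integral_exp_pos hγ y).ne')

theorem bbar_nonneg (ν : Measure ℝ) {β : ℝ} (hβ : β ∈ Ioo (0 : ℝ) 1) : 0 ≤ bbar ν β :=
  div_nonneg (mul_nonneg hβ.1.le (integral_nonneg fun _ => le_max_right _ _))
    (sub_nonneg.2 hβ.2.le)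

/-- A Jensen-type bound on the continuation value. -/
theorem memS0.contValue_le {ν : Measure ℝ} [IsProbabilityMeasure ν]
    (hint : Integrable (fun z => max z 0) ν) {β γ : ℝ} (hβ : β ∈ Ioo (0 : ℝ) 1)
    (hγ : 0 < γ) {v : ℝ → ℝ} (hv : memS0 ν β v) {y : ℝ} (hy : 0 ≤ y) :
    contValue ν β γ v y ≤ β * y + bbar ν β := by
  have hb := bbar_nonneg ν hβ
  set b := bbar ν β with hbdef
  set m := ∫ z, max z 0 ∂ν with hm
  have hβ1 : 0 < 1 - β := sub_pos.2 hβ.2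
  have hbm : β * (m + b) = b := by
    rw [hbdef, bbar]
    field_simp
    ring
  set c := Real.exp (-(γ * (y + m + b))) with hc
  have hle : c ≤ ∫ z, Real.exp (-(γ * v (y + z))) ∂ν := by
    have hI : Integrable (fun z => c * (1 + γ * m - γ * max z 0)) ν :=
      ((integrable_const _).sub (hint.const_mul γ)).const_mul c
    have heq : ∫ z, c * (1 + γ * m - γ * max z 0) ∂ν = c := by
      rw [integral_const_mul, integral_sub (integrable_const _) (hint.const_mul γ),
        integral_const_mul, ← hm]
      simp
    rw [← heq]
    refine integral_mono hI (hv.integrable_exp hγ y) fun z => ?_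
    have hvz : v (y + z) ≤ y + max z 0 + b := by
      rcases lt_or_ge (y + z) 0 with h | h
      · rw [hv.2.2.1 _ h]
        positivity
      · linarith [hv.2.1 _ h, le_max_left z 0]
    calc c * (1 + γ * m - γ * max z 0)
        ≤ c * Real.exp (γ * m - γ * max z 0) := by
          gcongr
          linarith [Real.add_one_le_exp (γ * m - γ * max z 0)]
      _ = Real.exp (-(γ * (y + max z 0 + b))) := by
          rw [hc, ← Real.exp_add]
          ring_nf
      _ ≤ Real.exp (-(γ * v (y + z))) := by gcongr
  have hlog := Real.log_le_log (Real.exp_pos _) hle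
  rw [Real.log_exp] at hlog
  have := mul_le_mul_of_nonneg_left hlog (div_pos hβ.1 hγ).le
  have hmul : β / γ * -(γ * (y + m + b)) = -(β * y + b) := by
    have : β / γ * -(γ * (y + m + b)) = -(β * y + β * (m + b)) := by
      field_simp
      ring
    rw [this, hbm]
  rw [contValue]
  linarith

theorem memS0.Tdiv_of_nonneg {ν : Measure ℝ} [IsProbabilityMeasure ν] {β γ : ℝ} (hγ : 0 < γ)
    {v : ℝ → ℝ} (hv : memS0 ν β v) {x : ℝ} (hx : 0 ≤ x) :
    Tdiv ν β γ v x = sSup ((fun a => a + contValue ν β γ v (x - a)) '' Icc 0 x) := by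
  rw [Tdiv, if_pos hx]
  congr 2
  ext a
  rw [contValue, ← hv.integral_Ici_add_measure_Iio hγ, neg_sub]
  ring

theorem memS0.continuousOn_Tdiv {ν : Measure ℝ} [IsProbabilityMeasure ν] [NullSingletonClass ν] {β γ : ℝ}
    (hγ : 0 < γ) {v : ℝ → ℝ} (hv : memS0 ν β v) : ContinuousOn (Tdiv ν β γ v) (Ici 0) := by
  have hG := hv.continuous_contValue hγ
  have hsup : Continuous fun x : ℝ =>
      sSup ((fun t : ℝ => x * t + contValue ν β γ v (x - x * t)) '' Icc 0 1) :=
    isCompact_Icc.continuous_sSup (by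
      show Continuous fun p : ℝ × ℝ => p.1 * p.2 + contValue ν β γ v (p.1 - p.1 * p.2)
      fun_prop)
  refine hsup.continuousOn.congr fun x hx => ?_
  have himage : Icc 0 x = (fun t => x * t) '' Icc 0 1 := by
    rw [image_mul_left_Icc hx zero_le_one, mul_zero, mul_one]
  rw [hv.Tdiv_of_nonneg hγ hx, himage, image_image]

/-- `T` maps `S₀` into `S₀`. -/
theorem Tdiv_maps_S0 (ν : Measure ℝ) [IsProbabilityMeasure ν]
    (hac : ν ≪ volume) (hint : Integrable (fun z => max z 0) ν)
    (hneg : 0 < ν (Iio 0)) (β γ : ℝ) (hβ : β ∈ Ioo (0:ℝ) 1) (hγ : 0 < γ)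
    (v : ℝ → ℝ) (hv : memS0 ν β v) :
    memS0 ν β (Tdiv ν β γ v) := by
  have : NullSingletonClass ν := ⟨fun x => hac (measure_singleton x)⟩
  have hub : ∀ x : ℝ, ∀ r ∈ (fun a => a + contValue ν β γ v (x - a)) '' Icc 0 x,
      r ≤ x + bbar ν β := by
    rintro x _ ⟨a, ha, rfl⟩
    have h0 : 0 ≤ x - a := sub_nonneg.2 ha.2
    have h1 := hv.contValue_le hint hβ hγ h0
    have h2 := mul_le_mul_of_nonneg_right hβ.2.le h0
    dsimp only
    linarith
  refine ⟨fun x => ?_, fun x hx => ?_, fun x hx => if_neg hx.not_ge, ?_,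
    hv.continuousOn_Tdiv hγ⟩
  · rcases lt_or_ge x 0 with hx | hx
    · exact (if_neg hx.not_ge).ge
    · rw [hv.Tdiv_of_nonneg hγ hx]
      refine Real.sSup_nonneg ?_
      rintro _ ⟨a, ha, rfl⟩
      exact add_nonneg ha.1 (hv.contValue_nonneg hβ.1 hγ _)
  · rw [hv.Tdiv_of_nonneg hγ hx]
    exact csSup_le ((nonempty_Icc.2 hx).image _) (hub x)
  · intro x hx y hy hxy
    rw [hv.Tdiv_of_nonneg hγ hx, hv.Tdiv_of_nonneg hγ hy]
    refine csSup_le ((nonempty_Icc.2 hx).image _) ?_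
    rintro _ ⟨a, ha, rfl⟩
    refine le_trans ?_ (le_csSup ⟨_, hub y⟩ ⟨a, ⟨ha.1, ha.2.trans hxy⟩, rfl⟩)
    have := hv.monotone_contValue hβ.1 hγ (sub_le_sub_right hxy a)
    dsimp only
    linarith
end

section
/- The operator U maps B into B and is a contraction with modulus β with respect to the supremum norm: for all b, c ∈ B, sup_{x≥0} |Ub(x) − Uc(x)| ≤ β · sup_{x≥0} |b(x) − c(x)|. -/
open MeasureTheory Set Filter Topology

noncomputable section

/-- The operator `U` acting on the bounded parts. -/
def Udiv (ν : Measure ℝ) (β γ : ℝ) (b : ℝ → ℝ) (x : ℝ) : ℝ :=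
  sSup ((fun u => -u - (β / γ) * Real.log
    ((∫ z in Ici (-u), Real.exp (-(γ * (u + z + b (u + z)))) ∂ν)
      + (ν (Iio (-u))).toReal)) '' Icc 0 x)

/-- Membership in the set `B`. -/
def memB (ν : Measure ℝ) (β : ℝ) (b : ℝ → ℝ) : Prop :=
  (∀ x, 0 ≤ x → 0 ≤ b x ∧ b x ≤ bbar ν β) ∧ ContinuousOn b (Ici 0)

end

noncomputable section

/-- The one-period discount factor `exp (-γ (y + b y))` in the region `y ≥ 0`, and `1` after ruin. -/
def ruinFactor (γ : ℝ) (b : ℝ → ℝ) (y : ℝ) : ℝ :=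
  (Ici (0:ℝ)).piecewise (fun y => Real.exp (-(γ * (y + b y)))) 1 y

/-- The expected value of `ruinFactor` after one step started from `u`. -/
def expFactor (ν : Measure ℝ) (γ : ℝ) (b : ℝ → ℝ) (u : ℝ) : ℝ :=
  ∫ z, ruinFactor γ b (u + z) ∂ν

/-- The objective maximized by `Udiv`. -/
def objective (ν : Measure ℝ) (β γ : ℝ) (b : ℝ → ℝ) (u : ℝ) : ℝ :=
  -u - (β / γ) * Real.log (expFactor ν γ b u)

end

theorem ruinFactor_of_nonneg {γ : ℝ} {b : ℝ → ℝ} {y : ℝ} (hy : 0 ≤ y) :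
    ruinFactor γ b y = Real.exp (-(γ * (y + b y))) :=
  piecewise_eq_of_mem _ _ _ hy

theorem ruinFactor_of_neg {γ : ℝ} {b : ℝ → ℝ} {y : ℝ} (hy : y < 0) : ruinFactor γ b y = 1 :=
  piecewise_eq_of_notMem _ _ _ (by simpa using hy)

theorem ruinFactor_pos (γ : ℝ) (b : ℝ → ℝ) (y : ℝ) : 0 < ruinFactor γ b y := by
  rcases le_or_gt 0 y with hy | hy
  · rw [ruinFactor_of_nonneg hy]; exact Real.exp_pos _
  · rw [ruinFactor_of_neg hy]; exact one_pos

theorem ruinFactor_le_one {γ : ℝ} {b : ℝ → ℝ} (hγ : 0 < γ) (hb : ∀ x, 0 ≤ x → 0 ≤ b x) (y : ℝ) :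
    ruinFactor γ b y ≤ 1 := by
  rcases le_or_gt 0 y with hy | hy
  · rw [ruinFactor_of_nonneg hy, Real.exp_le_one_iff, neg_nonpos]
    exact mul_nonneg hγ.le (add_nonneg hy (hb y hy))
  · rw [ruinFactor_of_neg hy]

theorem measurable_ruinFactor {γ : ℝ} {b : ℝ → ℝ} (hb : ContinuousOn b (Ici 0)) :
    Measurable (ruinFactor γ b) := by
  refine ContinuousOn.measurable_piecewise ?_ continuousOn_const measurableSet_Ici
  fun_prop

theorem continuousAt_ruinFactor {γ : ℝ} {b : ℝ → ℝ} (hb : ContinuousOn b (Ici 0)) {y : ℝ}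
    (hy : y ≠ 0) : ContinuousAt (ruinFactor γ b) y := by
  rcases hy.lt_or_gt with h | h
  · refine continuousAt_const.congr (f := fun _ => (1:ℝ)) ?_
    filter_upwards [Iio_mem_nhds h] with t ht using (ruinFactor_of_neg ht).symm
  · have hbc : ContinuousAt b y := hb.continuousAt (Ici_mem_nhds h)
    have : ContinuousAt (fun y => Real.exp (-(γ * (y + b y)))) y := by fun_prop
    refine this.congr ?_
    filter_upwards [Ioi_mem_nhds h] with t ht using (ruinFactor_of_nonneg (le_of_lt ht)).symm

section

variable {ν : Measure ℝ} [IsProbabilityMeasure ν] {β γ : ℝ} {b c : ℝ → ℝ}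

theorem integrable_ruinFactor (hγ : 0 < γ) (hb : ∀ x, 0 ≤ x → 0 ≤ b x)
    (hbc : ContinuousOn b (Ici 0)) (u : ℝ) : Integrable (fun z => ruinFactor γ b (u + z)) ν := by
  refine Integrable.of_bound
    ((measurable_ruinFactor hbc).comp (measurable_const_add u)).aestronglyMeasurable 1
    (ae_of_all _ fun z => ?_)
  rw [Real.norm_of_nonneg (ruinFactor_pos γ b _).le]
  exact ruinFactor_le_one hγ hb _

theorem expFactor_pos (hγ : 0 < γ) (hb : ∀ x, 0 ≤ x → 0 ≤ b x)
    (hbc : ContinuousOn b (Ici 0)) (u : ℝ) : 0 < expFactor ν γ b u := by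
  refine (integral_pos_iff_support_of_nonneg (fun z => (ruinFactor_pos γ b _).le)
    (integrable_ruinFactor hγ hb hbc u)).2 ?_
  have : Function.support (fun z => ruinFactor γ b (u + z)) = univ :=
    eq_univ_of_forall fun z => (ruinFactor_pos γ b _).ne'
  simp [this]

theorem expFactor_le_one (hγ : 0 < γ) (hb : ∀ x, 0 ≤ x → 0 ≤ b x)
    (hbc : ContinuousOn b (Ici 0)) (u : ℝ) : expFactor ν γ b u ≤ 1 := by
  simpa [expFactor] using integral_mono (integrable_ruinFactor hγ hb hbc u) (integrable_const (μ := ν) (1:ℝ))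
    fun z => ruinFactor_le_one hγ hb (u + z)

theorem expFactor_eq (hγ : 0 < γ) (hb : ∀ x, 0 ≤ x → 0 ≤ b x)
    (hbc : ContinuousOn b (Ici 0)) (u : ℝ) :
    (∫ z in Ici (-u), Real.exp (-(γ * (u + z + b (u + z)))) ∂ν) + (ν (Iio (-u))).toReal
      = expFactor ν γ b u := by
  rw [expFactor, ← integral_add_compl measurableSet_Ici (integrable_ruinFactor hγ hb hbc u),
    compl_Ici]
  congr 1
  · refine setIntegral_congr_fun measurableSet_Ici fun z hz => ?_
    exact (ruinFactor_of_nonneg (by linarith [mem_Ici.1 hz])).symm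
  · rw [setIntegral_congr_fun (g := fun _ => (1:ℝ)) measurableSet_Iio
      fun z hz => ruinFactor_of_neg (by linarith [mem_Iio.1 hz])]
    simp [Measure.real]

theorem continuous_expFactor (hac : ν ≪ volume) (hγ : 0 < γ) (hb : ∀ x, 0 ≤ x → 0 ≤ b x)
    (hbc : ContinuousOn b (Ici 0)) : Continuous (expFactor ν γ b) := by
  refine continuous_iff_continuousAt.2 fun u => ?_
  refine continuousAt_of_dominated (bound := fun _ => 1)
    (Eventually.of_forall fun v => (integrable_ruinFactor hγ hb hbc v).aestronglyMeasurable)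
    (Eventually.of_forall fun v => ae_of_all _ fun z => ?_) (integrable_const _) ?_
  · rw [Real.norm_of_nonneg (ruinFactor_pos γ b _).le]
    exact ruinFactor_le_one hγ hb _
  · have h0 : ∀ᵐ z ∂ν, z ≠ -u := hac.ae_le (Measure.ae_ne volume (-u))
    filter_upwards [h0] with z hz
    have hz' : u + z ≠ 0 := fun h => hz (by linarith)
    exact ContinuousAt.comp (g := ruinFactor γ b) (f := fun v => v + z)
      (continuousAt_ruinFactor hbc hz') (by fun_prop)

theorem continuous_objective (hac : ν ≪ volume) (hγ : 0 < γ) (hb : ∀ x, 0 ≤ x → 0 ≤ b x)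
    (hbc : ContinuousOn b (Ici 0)) : Continuous (objective ν β γ b) := by
  have h := (continuous_expFactor hac hγ hb hbc).log fun u => (expFactor_pos hγ hb hbc u).ne'
  unfold objective
  fun_prop

theorem Udiv_eq (hγ : 0 < γ) (hb : ∀ x, 0 ≤ x → 0 ≤ b x) (hbc : ContinuousOn b (Ici 0)) (x : ℝ) :
    Udiv ν β γ b x = sSup (objective ν β γ b '' Icc 0 x) := by
  simp only [Udiv, expFactor_eq hγ hb hbc]
  rfl

theorem neg_log_expFactor_le (hint : Integrable (fun z => max z 0) ν) (hγ : 0 < γ)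
    (hb : ∀ x, 0 ≤ x → 0 ≤ b x) (hbc : ContinuousOn b (Ici 0)) {M : ℝ}
    (hM : ∀ x, 0 ≤ x → b x ≤ M) {u : ℝ} (hu : 0 ≤ u) :
    -Real.log (expFactor ν γ b u) ≤ γ * (u + (∫ z, max z 0 ∂ν) + M) := by
  have hi : Integrable (fun z => -(γ * (u + max z 0 + M))) ν :=
    ((((integrable_const u).add hint).add (integrable_const M)).const_mul γ).neg
  have hM0 : 0 ≤ M := (hb 0 le_rfl).trans (hM 0 le_rfl)
  have hle : ∀ z, Real.exp (-(γ * (u + max z 0 + M))) ≤ ruinFactor γ b (u + z) := fun z => by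
    rcases le_or_gt 0 (u + z) with h | h
    · rw [ruinFactor_of_nonneg h, Real.exp_le_exp, neg_le_neg_iff]
      exact mul_le_mul_of_nonneg_left
        (add_le_add (add_le_add_right (le_max_left _ _) _) (hM _ h)) hγ.le
    · rw [ruinFactor_of_neg h, Real.exp_le_one_iff, neg_nonpos]
      have := le_max_right z 0
      positivity
  have hie : Integrable (fun z => Real.exp (-(γ * (u + max z 0 + M)))) ν :=
    (integrable_ruinFactor hγ hb hbc u).mono'
      (Real.continuous_exp.comp_aestronglyMeasurable hi.aestronglyMeasurable)
      (ae_of_all _ fun z => by rw [Real.norm_of_nonneg (Real.exp_pos _).le]; exact hle z)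
  have hJ : Real.exp (∫ z, -(γ * (u + max z 0 + M)) ∂ν)
      ≤ ∫ z, Real.exp (-(γ * (u + max z 0 + M))) ∂ν :=
    convexOn_exp.map_integral_le Real.continuous_exp.continuousOn isClosed_univ
      (ae_of_all _ fun _ => mem_univ _) hi hie
  have hval : ∫ z, -(γ * (u + max z 0 + M)) ∂ν = -(γ * (u + (∫ z, max z 0 ∂ν) + M)) := by
    rw [integral_neg, integral_const_mul,
      integral_add (f := fun z => u + max z 0) ((integrable_const u).add hint)
        (integrable_const M),
      integral_add (integrable_const u) hint]
    simp
  rw [hval] at hJ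
  have := (Real.le_log_iff_exp_le (expFactor_pos hγ hb hbc u)).2
    (hJ.trans (integral_mono hie (integrable_ruinFactor hγ hb hbc u) hle))
  linarith

theorem objective_le_bbar (hint : Integrable (fun z => max z 0) ν) (hβ : β ∈ Ioo (0:ℝ) 1)
    (hγ : 0 < γ) (hb : memB ν β b) {u : ℝ} (hu : 0 ≤ u) : objective ν β γ b u ≤ bbar ν β := by
  have h := neg_log_expFactor_le hint hγ (fun x hx => (hb.1 x hx).1) hb.2
    (fun x hx => (hb.1 x hx).2) hu
  have hm := mul_le_mul_of_nonneg_left h (div_nonneg hβ.1.le hγ.le)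
  have hc : β / γ * (γ * (u + (∫ z, max z 0 ∂ν) + bbar ν β))
      = β * (u + (∫ z, max z 0 ∂ν) + bbar ν β) := by
    field_simp
  have h1 : 0 < 1 - β := sub_pos.2 hβ.2
  have hbb : (1 - β) * bbar ν β = β * ∫ z, max z 0 ∂ν := mul_div_cancel₀ _ h1.ne'
  have hbu : 0 ≤ (1 - β) * u := mul_nonneg h1.le hu
  unfold objective
  linarith

theorem objective_zero_nonneg (hβ : 0 ≤ β) (hγ : 0 < γ) (hb : ∀ x, 0 ≤ x → 0 ≤ b x)
    (hbc : ContinuousOn b (Ici 0)) : 0 ≤ objective ν β γ b 0 := by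
  have h := Real.log_nonpos (expFactor_pos (ν := ν) hγ hb hbc 0).le (expFactor_le_one hγ hb hbc 0)
  have := mul_nonpos_of_nonneg_of_nonpos (div_nonneg hβ hγ.le) h
  unfold objective
  linarith

theorem objective_le_add (hβ : 0 ≤ β) (hγ : 0 < γ)
    (hb : ∀ x, 0 ≤ x → 0 ≤ b x) (hbc : ContinuousOn b (Ici 0))
    (hc : ∀ x, 0 ≤ x → 0 ≤ c x) (hcc : ContinuousOn c (Ici 0)) {D : ℝ}
    (hD : ∀ x, 0 ≤ x → |b x - c x| ≤ D) (u : ℝ) :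
    objective ν β γ b u ≤ objective ν β γ c u + β * D := by
  have hD0 : 0 ≤ D := (abs_nonneg _).trans (hD 0 le_rfl)
  have hle : ∀ y, ruinFactor γ c y ≤ Real.exp (γ * D) * ruinFactor γ b y := fun y => by
    rcases le_or_gt 0 y with h | h
    · rw [ruinFactor_of_nonneg h, ruinFactor_of_nonneg h, ← Real.exp_add, Real.exp_le_exp]
      have := mul_le_mul_of_nonneg_left ((le_abs_self _).trans (hD y h)) hγ.le
      linarith
    · rw [ruinFactor_of_neg h, ruinFactor_of_neg h, mul_one, Real.one_le_exp_iff]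
      positivity
  have hint := integral_mono (μ := ν) (integrable_ruinFactor hγ hc hcc u)
    ((integrable_ruinFactor hγ hb hbc u).const_mul (Real.exp (γ * D))) fun z => hle (u + z)
  rw [integral_const_mul] at hint
  change expFactor ν γ c u ≤ Real.exp (γ * D) * expFactor ν γ b u at hint
  have hlog := Real.log_le_log (expFactor_pos hγ hc hcc u) hint
  rw [Real.log_mul (Real.exp_pos _).ne' (expFactor_pos hγ hb hbc u).ne', Real.log_exp] at hlog
  have hm := mul_le_mul_of_nonneg_left hlog (div_nonneg hβ hγ.le)
  have hcancel : β / γ * (γ * D) = β * D := by field_simp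
  unfold objective
  linarith

theorem Udiv_le_add (hac : ν ≪ volume) (hβ : 0 ≤ β) (hγ : 0 < γ)
    (hb : ∀ x, 0 ≤ x → 0 ≤ b x) (hbc : ContinuousOn b (Ici 0))
    (hc : ∀ x, 0 ≤ x → 0 ≤ c x) (hcc : ContinuousOn c (Ici 0)) {D : ℝ}
    (hD : ∀ x, 0 ≤ x → |b x - c x| ≤ D) {x : ℝ} (hx : 0 ≤ x) :
    Udiv ν β γ b x ≤ Udiv ν β γ c x + β * D := by
  rw [Udiv_eq hγ hb hbc, Udiv_eq hγ hc hcc]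
  refine csSup_le ((nonempty_Icc.2 hx).image _) ?_
  rintro _ ⟨u, hu, rfl⟩
  refine (objective_le_add hβ hγ hb hbc hc hcc hD u).trans (add_le_add_left ?_ _)
  exact le_csSup (isCompact_Icc.bddAbove_image (continuous_objective hac hγ hc hcc).continuousOn)
    (mem_image_of_mem _ hu)

end

theorem Continuous.continuousOn_sSup_image_Icc {f : ℝ → ℝ} (hf : Continuous f) :
    ContinuousOn (fun x => sSup (f '' Icc 0 x)) (Ici 0) := by
  have h : Continuous fun x => sSup ((fun t => f (x * t)) '' Icc (0:ℝ) 1) :=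
    isCompact_Icc.continuous_sSup (f := fun x t => f (x * t)) (by fun_prop)
  refine h.continuousOn.congr fun x hx => ?_
  have himg : (fun t => x * t) '' Icc (0:ℝ) 1 = Icc 0 x := by
    rw [image_mul_left_Icc hx zero_le_one, mul_zero, mul_one]
  simp only
  rw [← himg, image_image]

theorem Udiv_memB {ν : Measure ℝ} [IsProbabilityMeasure ν] (hac : ν ≪ volume)
    (hint : Integrable (fun z => max z 0) ν) {β γ : ℝ} (hβ : β ∈ Ioo (0:ℝ) 1) (hγ : 0 < γ)
    {b : ℝ → ℝ} (hb : memB ν β b) : memB ν β (Udiv ν β γ b) := by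
  have hb0 := fun x hx => (hb.1 x hx).1
  have hcont := continuous_objective (β := β) hac hγ hb0 hb.2
  have hU : Udiv ν β γ b = fun x => sSup (objective ν β γ b '' Icc 0 x) :=
    funext (Udiv_eq hγ hb0 hb.2)
  rw [hU]
  refine ⟨fun x hx => ⟨?_, ?_⟩, hcont.continuousOn_sSup_image_Icc⟩
  · exact (objective_zero_nonneg hβ.1.le hγ hb0 hb.2).trans <|
      le_csSup (isCompact_Icc.bddAbove_image hcont.continuousOn)
        (mem_image_of_mem _ (left_mem_Icc.2 hx))
  · refine csSup_le ((nonempty_Icc.2 hx).image _) ?_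
    rintro _ ⟨u, hu, rfl⟩
    exact objective_le_bbar hint hβ hγ hb hu.1

/-- `U` maps `B` into `B` and is a contraction with modulus `β`
with respect to the supremum norm on `[0,∞)`. -/
theorem Udiv_contraction (ν : Measure ℝ) [IsProbabilityMeasure ν]
    (hac : ν ≪ volume) (hint : Integrable (fun z => max z 0) ν)
    (hneg : 0 < ν (Iio 0)) (β γ : ℝ) (hβ : β ∈ Ioo (0:ℝ) 1) (hγ : 0 < γ)
    (b c : ℝ → ℝ) (hb : memB ν β b) (hc : memB ν β c) :
    memB ν β (Udiv ν β γ b) ∧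
    (⨆ x : Ici (0:ℝ), |Udiv ν β γ b x - Udiv ν β γ c x|) ≤
      β * ⨆ x : Ici (0:ℝ), |b x - c x| := by
  have hb0 := fun x hx => (hb.1 x hx).1
  have hc0 := fun x hx => (hc.1 x hx).1
  refine ⟨Udiv_memB hac hint hβ hγ hb, ?_⟩
  have hbdd : BddAbove (range fun x : Ici (0:ℝ) => |b x - c x|) := by
    refine ⟨bbar ν β, ?_⟩
    rintro _ ⟨⟨x, hx⟩, rfl⟩
    obtain ⟨h1, h2⟩ := hb.1 x hx
    obtain ⟨h3, h4⟩ := hc.1 x hx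
    exact abs_le.2 ⟨by linarith, by linarith⟩
  have hD : ∀ x, 0 ≤ x → |b x - c x| ≤ ⨆ x : Ici (0:ℝ), |b x - c x| :=
    fun x hx => le_ciSup hbdd ⟨x, hx⟩
  have hD' : ∀ x, 0 ≤ x → |c x - b x| ≤ ⨆ x : Ici (0:ℝ), |b x - c x| :=
    fun x hx => abs_sub_comm (b x) (c x) ▸ hD x hx
  refine ciSup_le fun ⟨x, hx⟩ => ?_
  have h1 := Udiv_le_add hac hβ.1.le hγ hb0 hb.2 hc0 hc.2 hD hx
  have h2 := Udiv_le_add hac hβ.1.le hγ hc0 hc.2 hb0 hb.2 hD' hx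
  exact abs_le.2 ⟨by linarith, by linarith⟩
end

section
/- For every J₀ ∈ S, the iterates Tⁿ J₀ converge pointwise on ℝ as n → ∞ to the unique fixed point J of T in S. -/
open MeasureTheory Set Filter Topology

/-- Monotone functions vanishing on the negative half-line. -/
structure Admissible (v : ℝ → ℝ) : Prop where
  mono : Monotone v
  eq_zero : ∀ x < 0, v x = 0

namespace Admissible

variable {v w : ℝ → ℝ} {ν : Measure ℝ} {β γ : ℝ}

theorem nonneg (hv : Admissible v) (x : ℝ) : 0 ≤ v x := by
  rw [← hv.eq_zero (min x 0 - 1) (by linarith [min_le_right x 0])]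
  exact hv.mono (by linarith [min_le_left x 0])

theorem of_memS (hv : memS ν β v) : Admissible v := by
  obtain ⟨h0, -, hn, hm, -⟩ := hv
  refine ⟨fun x y hxy => ?_, hn⟩
  rcases lt_or_ge x 0 with hx | hx
  · rw [hn x hx]
    exact h0 y
  · exact hm hx (hx.trans hxy) hxy

variable [IsProbabilityMeasure ν]

theorem integrable_exp (hv : Admissible v) (hγ : 0 < γ) (y : ℝ) :
    Integrable (fun z => Real.exp (-(γ * v (y + z)))) ν := by
  have hm : Measurable v := hv.mono.measurable
  refine Integrable.of_bound (C := 1) (Measurable.aestronglyMeasurable (by fun_prop))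
    (ae_of_all _ fun z => ?_)
  rw [Real.norm_eq_abs, Real.abs_exp, Real.exp_le_one_iff, neg_nonpos]
  exact mul_nonneg hγ.le (hv.nonneg _)

theorem setIntegral_add_measure (hv : Admissible v) (hγ : 0 < γ) (x a : ℝ) :
    (∫ z in Ici (a - x), Real.exp (-(γ * v (x - a + z))) ∂ν) + (ν (Iio (a - x))).toReal
      = ∫ z, Real.exp (-(γ * v (x - a + z))) ∂ν := by
  rw [← integral_add_compl (measurableSet_Ici (a := a - x))
    (hv.integrable_exp (ν := ν) hγ (x - a)), compl_Ici]
  have h : ∫ z in Iio (a - x), Real.exp (-(γ * v (x - a + z))) ∂ν = ∫ _ in Iio (a - x), 1 ∂ν :=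
    setIntegral_congr_fun measurableSet_Iio fun z (hz : z < a - x) => by
      simp [hv.eq_zero (x - a + z) (by linarith)]
  rw [h]
  simp [Measure.real]

theorem integral_exp_pos (hv : Admissible v) (hγ : 0 < γ) (y : ℝ) :
    0 < ∫ z, Real.exp (-(γ * v (y + z))) ∂ν :=
  MeasureTheory.integral_exp_pos (hv.integrable_exp hγ y)

theorem log_integral_exp_nonpos (hv : Admissible v) (hγ : 0 < γ) (y : ℝ) :
    Real.log (∫ z, Real.exp (-(γ * v (y + z))) ∂ν) ≤ 0 := by
  refine Real.log_nonpos (hv.integral_exp_pos hγ y).le ?_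
  calc ∫ z, Real.exp (-(γ * v (y + z))) ∂ν ≤ ∫ _, (1 : ℝ) ∂ν :=
        integral_mono (hv.integrable_exp hγ y) (integrable_const _) fun z => by
          simpa using mul_nonneg hγ.le (hv.nonneg (y + z))
    _ = 1 := by simp

theorem log_integral_exp_le_add (hv : Admissible v) (hw : Admissible w) (hγ : 0 < γ) {c : ℝ}
    {y y' : ℝ} (h : ∀ z, v (y + z) ≤ w (y' + z) + c) :
    Real.log (∫ z, Real.exp (-(γ * w (y' + z))) ∂ν)
      ≤ Real.log (∫ z, Real.exp (-(γ * v (y + z))) ∂ν) + γ * c := by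
  rw [← sub_le_iff_le_add, sub_eq_neg_add, ← Real.log_exp (-(γ * c)),
    ← Real.log_mul (Real.exp_ne_zero _) (hw.integral_exp_pos hγ y').ne']
  refine Real.log_le_log (mul_pos (Real.exp_pos _) (hw.integral_exp_pos hγ y')) ?_
  rw [← integral_const_mul]
  refine integral_mono ((hw.integrable_exp hγ y').const_mul _) (hv.integrable_exp hγ y)
    fun z => ?_
  simp only [← Real.exp_add, Real.exp_le_exp]
  nlinarith [h z]

theorem Tdiv_eq (hv : Admissible v) (hγ : 0 < γ) {x : ℝ} (hx : 0 ≤ x) :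
    Tdiv ν β γ v x = sSup ((fun a => a - (β / γ) *
      Real.log (∫ z, Real.exp (-(γ * v (x - a + z))) ∂ν)) '' Icc 0 x) := by
  simp only [Tdiv, if_pos hx, hv.setIntegral_add_measure hγ]

theorem bddAbove_objective (hv : Admissible v) (hβ : 0 < β) (hγ : 0 < γ) (x : ℝ) :
    BddAbove ((fun a => a - (β / γ) *
      Real.log (∫ z, Real.exp (-(γ * v (x - a + z))) ∂ν)) '' Icc 0 x) := by
  refine ⟨x - (β / γ) * Real.log (∫ z, Real.exp (-(γ * v (x + z))) ∂ν), ?_⟩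
  rintro _ ⟨a, ⟨h0, hx⟩, rfl⟩
  have := hv.log_integral_exp_le_add (ν := ν) hv hγ (c := 0) (y := x - a) (y' := x)
    fun z => by linarith [hv.mono (show x - a + z ≤ x + z by linarith)]
  have := mul_le_mul_of_nonneg_left this (div_pos hβ hγ).le
  simp only [mul_zero, add_zero] at this
  linarith

theorem le_Tdiv (hv : Admissible v) (hβ : 0 < β) (hγ : 0 < γ) {x a : ℝ} (ha : a ∈ Icc 0 x) :
    a - (β / γ) * Real.log (∫ z, Real.exp (-(γ * v (x - a + z))) ∂ν) ≤ Tdiv ν β γ v x := by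
  rw [hv.Tdiv_eq hγ (ha.1.trans ha.2)]
  exact le_csSup (hv.bddAbove_objective hβ hγ x) (mem_image_of_mem _ ha)

theorem Tdiv_le (hv : Admissible v) (hγ : 0 < γ) {x B : ℝ} (hx : 0 ≤ x)
    (h : ∀ a ∈ Icc 0 x,
      a - (β / γ) * Real.log (∫ z, Real.exp (-(γ * v (x - a + z))) ∂ν) ≤ B) :
    Tdiv ν β γ v x ≤ B := by
  rw [hv.Tdiv_eq hγ hx]
  exact csSup_le ((nonempty_Icc.2 hx).image _) (forall_mem_image.2 h)

theorem Tdiv_le_add (hv : Admissible v) (hw : Admissible w) (hβ : 0 < β) (hγ : 0 < γ) {c : ℝ}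
    (hc : 0 ≤ c) (h : ∀ x, v x ≤ w x + c) (x : ℝ) :
    Tdiv ν β γ v x ≤ Tdiv ν β γ w x + β * c := by
  rcases lt_or_ge x 0 with hx | hx
  · simp only [Tdiv, if_neg hx.not_ge, zero_add]
    positivity
  · refine hv.Tdiv_le hγ hx fun a ha => ?_
    have h₁ := mul_le_mul_of_nonneg_left (hv.log_integral_exp_le_add (ν := ν) hw hγ
      fun z => h (x - a + z)) (div_pos hβ hγ).le
    rw [mul_add, show β / γ * (γ * c) = β * c by field_simp] at h₁
    linarith [hw.le_Tdiv (ν := ν) hβ hγ ha]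

theorem monotone_Tdiv (hv : Admissible v) (hβ : 0 < β) (hγ : 0 < γ) :
    Monotone (Tdiv ν β γ v) := by
  intro x y hxy
  rcases lt_or_ge y 0 with hy | hy
  · simp [Tdiv, hy.not_ge, (hxy.trans_lt hy).not_ge]
  rcases lt_or_ge x 0 with hx | hx
  · have h₁ := hv.le_Tdiv (ν := ν) hβ hγ (right_mem_Icc.2 hy)
    have h₂ := mul_nonpos_of_nonneg_of_nonpos (div_pos hβ hγ).le
      (hv.log_integral_exp_nonpos (ν := ν) hγ (y - y))
    rw [Tdiv, if_neg hx.not_ge]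
    linarith
  · refine hv.Tdiv_le hγ hx fun a ha => ?_
    have h₁ := hv.le_Tdiv (ν := ν) hβ hγ (x := y) (a := a + (y - x))
      ⟨by linarith [ha.1], by linarith [ha.2]⟩
    rw [show y - (a + (y - x)) = x - a by ring] at h₁
    linarith

theorem admissible_Tdiv (hv : Admissible v) (hβ : 0 < β) (hγ : 0 < γ) :
    Admissible (Tdiv ν β γ v) :=
  ⟨hv.monotone_Tdiv hβ hγ, fun _ hx => if_neg hx.not_ge⟩

theorem iterate_Tdiv (hv : Admissible v) (hw : Admissible w) (hβ : 0 < β)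
    (hγ : 0 < γ) (hfix : Tdiv ν β γ w = w) {c : ℝ} (h : ∀ x, |v x - w x| ≤ c) (n : ℕ) :
    Admissible ((Tdiv ν β γ)^[n] v) ∧ ∀ x, |(Tdiv ν β γ)^[n] v x - w x| ≤ β ^ n * c := by
  have hc : 0 ≤ c := (abs_nonneg _).trans (h 0)
  induction n with
  | zero => exact ⟨hv, by simpa using h⟩
  | succ n ih =>
    obtain ⟨hu, hd⟩ := ih
    rw [Function.iterate_succ_apply']
    have hcn : 0 ≤ β ^ n * c := by positivity
    have h₁ : ∀ x, (Tdiv ν β γ)^[n] v x ≤ w x + β ^ n * c := fun x => by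
      linarith [(abs_le.1 (hd x)).2]
    have h₂ : ∀ x, w x ≤ (Tdiv ν β γ)^[n] v x + β ^ n * c := fun x => by
      linarith [(abs_le.1 (hd x)).1]
    refine ⟨hu.admissible_Tdiv hβ hγ, fun x => ?_⟩
    have h₃ := hu.Tdiv_le_add (ν := ν) hw hβ hγ hcn h₁ x
    have h₄ := hw.Tdiv_le_add (ν := ν) hu hβ hγ hcn h₂ x
    rw [hfix] at h₃ h₄
    rw [pow_succ', mul_assoc, abs_le]
    constructor <;> linarith

end Admissible

theorem abs_sub_le_of_memS {ν : Measure ℝ} {β : ℝ} {v w : ℝ → ℝ} (hv : memS ν β v)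
    (hw : memS ν β w) (x : ℝ) : |v x - w x| ≤ bbar ν β := by
  rcases lt_or_ge x 0 with hx | hx
  · have h := hv.2.1 0 le_rfl
    simpa [hv.2.2.1 x hx, hw.2.2.1 x hx] using h.1.trans h.2
  · have h₁ := hv.2.1 x hx
    have h₂ := hw.2.1 x hx
    rw [abs_le]
    constructor <;> linarith

/-- for every `J₀ ∈ S`, the iterates `Tⁿ J₀` converge pointwise
to the unique fixed point `J` of `T` in `S`. -/
theorem value_iteration_converges_general (ν : Measure ℝ) [IsProbabilityMeasure ν]
    (hac : ν ≪ volume) (hint : Integrable (fun z => max z 0) ν)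
    (hneg : 0 < ν (Iio 0)) (β γ : ℝ) (hβ : β ∈ Ioo (0:ℝ) 1) (hγ : 0 < γ)
    (J : ℝ → ℝ) (hJ : memS ν β J) (hfix : Tdiv ν β γ J = J)
    (J₀ : ℝ → ℝ) (hJ₀ : memS ν β J₀) :
    ∀ x : ℝ, Tendsto (fun n => (Tdiv ν β γ)^[n] J₀ x) atTop (𝓝 (J x)) := by
  intro x
  have h := fun n => ((Admissible.of_memS hJ₀).iterate_Tdiv (.of_memS hJ) hβ.1 hγ hfix
    (abs_sub_le_of_memS hJ₀ hJ) n).2 x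
  have hlim : Tendsto (fun n => β ^ n * bbar ν β) atTop (𝓝 0) := by
    simpa using (tendsto_pow_atTop_nhds_zero_of_lt_one hβ.1.le hβ.2).mul_const (bbar ν β)
  rw [tendsto_iff_dist_tendsto_zero]
  exact squeeze_zero (fun _ => dist_nonneg) h hlim
end

section
/- If J ∈ S satisfies TJ = J, then for all x ≥ y ≥ 0 one has J(x) − J(y) ≥ x − y. -/
open MeasureTheory Set Filter Topology

/-- if `J ∈ S` is a fixed point of `T`, then `J(x) - J(y) ≥ x - y`
for all `x ≥ y ≥ 0`. -/
theorem fixed_point_slope_ge_one (ν : Measure ℝ) [IsProbabilityMeasure ν]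
    (hac : ν ≪ volume) (hint : Integrable (fun z => max z 0) ν)
    (hneg : 0 < ν (Iio 0)) (β γ : ℝ) (hβ : β ∈ Ioo (0:ℝ) 1) (hγ : 0 < γ)
    (J : ℝ → ℝ) (hJ : memS ν β J) (hfix : Tdiv ν β γ J = J) :
    ∀ x y : ℝ, 0 ≤ y → y ≤ x → x - y ≤ J x - J y := by
  intro x y hy hyx
  have hx : 0 ≤ x := hy.trans hyx
  have hJx := (hJ.2.1 x hx).1
  have hTx := congrFun hfix x
  have hTy := congrFun hfix y
  simp only [Tdiv, if_pos hx] at hTx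
  simp only [Tdiv, if_pos hy] at hTy
  set f : ℝ → ℝ → ℝ := fun x a => a - (β / γ) * Real.log
      ((∫ z in Ici (a - x), Real.exp (-(γ * J (x - a + z))) ∂ν)
        + (ν (Iio (a - x))).toReal) with hf
  change sSup (f x '' Icc 0 x) = J x at hTx
  change sSup (f y '' Icc 0 y) = J y at hTy
  by_cases hbdd : BddAbove (f x '' Icc 0 x)
  · have hle : J y ≤ J x - (x - y) := by
      rw [← hTy]
      refine csSup_le ((nonempty_Icc.2 hy).image _) ?_
      rintro _ ⟨a, ha, rfl⟩
      have hmem : a + (x - y) ∈ Icc 0 x := ⟨by linarith [ha.1], by linarith [ha.2]⟩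
      have hsup : f x (a + (x - y)) ≤ J x := hTx ▸ le_csSup hbdd (mem_image_of_mem _ hmem)
      have hshift : f x (a + (x - y)) = f y a + (x - y) := by
        have h₁ : a + (x - y) - x = a - y := by ring
        have h₂ : x - (a + (x - y)) = y - a := by ring
        simp only [hf, h₁, h₂]
        ring
      linarith
    linarith
  · -- The junk value `sSup = 0` of an unbounded set contradicts `x ≤ J x` unless `x = 0`.
    rw [Real.sSup_of_not_bddAbove hbdd] at hTx
    obtain rfl : x = y := by linarith
    simp
end

section
/- Let x ≥ 0 and let a* be the greatest element of the set of maximizers { a ∈ [0,x] : a + Γ(x−a) = J(x) }. Then J(x − a*) = J(x) − a*, and 0 is the greatest element of the set of maximizers { a ∈ [0, x−a*] : a + Γ(x−a*−a) = J(x−a*) }. -/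
open MeasureTheory Set Filter Topology

/-- A fixed point `J` of `T` in `S` is the least upper bound of `a + Γ (x - a)` over
`a ∈ [0, x]`. Boundedness comes from `x ≤ J x`: an unbounded set would have `sSup` equal to `0`,
forcing `x = 0`. -/
theorem isLUB_add_Gam {ν : Measure ℝ} {β γ : ℝ} {J : ℝ → ℝ} (hJ : memS ν β J)
    (hfix : Tdiv ν β γ J = J) {x : ℝ} (hx : 0 ≤ x) :
    IsLUB ((fun a => a + Gam ν β γ J (x - a)) '' Icc 0 x) (J x) := by
  have hsup : J x = sSup ((fun a => a + Gam ν β γ J (x - a)) '' Icc 0 x) := by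
    conv_lhs => rw [← hfix]
    simp only [Tdiv, Gam, if_pos hx, neg_sub, neg_mul, ← sub_eq_add_neg]
  have hbdd : BddAbove ((fun a => a + Gam ν β γ J (x - a)) '' Icc 0 x) := by
    by_contra h
    have hJx : J x = 0 := by rw [hsup, Real.sSup_of_not_bddAbove h]
    have hx0 : x = 0 := le_antisymm (hJx ▸ (hJ.2.1 x hx).1) hx
    subst hx0
    exact h (by simp)
  rw [hsup]
  exact isLUB_csSup ((nonempty_Icc.2 hx).image _) hbdd

/-- if `a*` is the greatest maximizer at `x`, then
`J(x - a*) = J(x) - a*` and `0` is the greatest maximizer at `x - a*`. -/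
theorem largest_maximizer_property (ν : Measure ℝ) [IsProbabilityMeasure ν]
    (hac : ν ≪ volume) (hint : Integrable (fun z => max z 0) ν)
    (hneg : 0 < ν (Iio 0)) (β γ : ℝ) (hβ : β ∈ Ioo (0:ℝ) 1) (hγ : 0 < γ)
    (J : ℝ → ℝ) (hJ : memS ν β J) (hfix : Tdiv ν β γ J = J)
    (x : ℝ) (hx : 0 ≤ x) (astar : ℝ)
    (hastar : IsGreatest {a | a ∈ Icc 0 x ∧ a + Gam ν β γ J (x - a) = J x} astar) :
    J (x - astar) = J x - astar ∧
    IsGreatest {a | a ∈ Icc 0 (x - astar) ∧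
      a + Gam ν β γ J (x - astar - a) = J (x - astar)} 0 := by
  obtain ⟨⟨⟨h0, hle⟩, hmax⟩, hgreatest⟩ := hastar
  have hy : 0 ≤ x - astar := sub_nonneg.2 hle
  have hlubx := isLUB_add_Gam hJ hfix hx
  have hluby := isLUB_add_Gam hJ hfix hy
  have hshift : J (x - astar) = J x - astar := by
    apply le_antisymm
    · refine hluby.2 ?_
      rintro _ ⟨a, ha, rfl⟩
      have h := hlubx.1 ⟨astar + a, ⟨by linarith [ha.1], by linarith [ha.2]⟩, rfl⟩
      simp only [← sub_sub] at h
      simp only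
      linarith
    · have h := hluby.1 ⟨0, ⟨le_rfl, hy⟩, rfl⟩
      simp only [sub_zero] at h
      linarith
  refine ⟨hshift, ⟨⟨le_rfl, hy⟩, ?_⟩, ?_⟩
  · rw [sub_zero, hshift]
    linarith
  · rintro a ⟨ha, hmaxa⟩
    have h : astar + a ≤ astar := by
      refine hgreatest ⟨⟨by linarith [ha.1], by linarith [ha.2]⟩, ?_⟩
      rw [← sub_sub]
      linarith
    linarith
end

section
/- If x ≥ 0 is such that a = 0 attains the supremum in the fixed point equation, i.e. J(x) = Γ(x), then x ≤ b̄/(1−β). Consequently ξ := sup{ x ≥ 0 : 0 is the greatest maximizer of a ↦ a + Γ(x−a) on [0,x] } is finite. -/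
open MeasureTheory Set Filter Topology

/-- `Γ x ≤ β (x + E[z⁺] + b̄)`, by Jensen's inequality and the upper bound on `J`. -/
theorem Gam_le (ν : Measure ℝ) [IsProbabilityMeasure ν]
    (hint : Integrable (fun z => max z 0) ν) {β γ : ℝ} (hβ : β ∈ Ioo (0:ℝ) 1) (hγ : 0 < γ)
    {J : ℝ → ℝ} (hJ : memS ν β J) {x : ℝ} (hx : 0 ≤ x) :
    Gam ν β γ J x ≤ β * (x + (∫ z, max z 0 ∂ν) + bbar ν β) := by
  obtain ⟨hβ0, hβ1⟩ := hβ
  obtain ⟨hnn, hbd, -, -, hcont⟩ := hJ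
  have hm : 0 ≤ ∫ z, max z 0 ∂ν := integral_nonneg fun z => le_max_right z 0
  have hb : 0 ≤ bbar ν β := div_nonneg (mul_nonneg hβ0.le hm) (by linarith)
  set m := ∫ z, max z 0 ∂ν with hmdef
  set b := bbar ν β
  set c := x + m + b with hc
  -- the tangent line of `y ↦ exp (-γ y)` at `c`, evaluated at `x + z⁺ + b̄`
  let l : ℝ → ℝ := fun z => Real.exp (-(γ * c)) * (1 - γ * (max z 0 - m))
  have hint' : Integrable (fun z => max z 0 - m) ν := hint.sub (integrable_const m)
  have hl : Integrable l ν :=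
    ((integrable_const (1 : ℝ)).sub (hint'.const_mul γ)).const_mul _
  have hl_int : ∫ z, l z ∂ν = Real.exp (-(γ * c)) := by
    simp only [l]
    rw [integral_const_mul, integral_sub (integrable_const _) (hint'.const_mul γ),
      integral_const_mul, integral_sub hint (integrable_const m), ← hmdef]
    simp
  have hl_le : ∀ z, l z ≤ Real.exp (-(γ * (x + max z 0 + b))) := by
    intro z
    have h := Real.add_one_le_exp (-(γ * (max z 0 - m)))
    have he : Real.exp (-(γ * (x + max z 0 + b)))
        = Real.exp (-(γ * c)) * Real.exp (-(γ * (max z 0 - m))) := by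
      rw [← Real.exp_add]; congr 1; rw [hc]; ring
    rw [he]
    exact mul_le_mul_of_nonneg_left (by linarith) (Real.exp_pos _).le
  have hcJ : ContinuousOn (fun z => Real.exp (-(γ * J (x + z)))) (Ici (-x)) := by
    have : ContinuousOn (fun z => J (x + z)) (Ici (-x)) :=
      hcont.comp (by fun_prop) fun z hz => by
        simp only [mem_Ici] at hz ⊢; linarith
    exact Real.continuous_exp.comp_continuousOn (this.const_mul γ).neg
  have hJint : IntegrableOn (fun z => Real.exp (-(γ * J (x + z)))) (Ici (-x)) ν := by
    refine Integrable.of_bound (hcJ.aestronglyMeasurable measurableSet_Ici) 1 (ae_of_all _ ?_)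
    intro z
    rw [Real.norm_of_nonneg (Real.exp_pos _).le, Real.exp_le_one_iff]
    have := mul_nonneg hγ.le (hnn (x + z))
    linarith
  have h1 : ∫ z in Ici (-x), l z ∂ν ≤ ∫ z in Ici (-x), Real.exp (-(γ * J (x + z))) ∂ν := by
    refine setIntegral_mono_on hl.integrableOn hJint measurableSet_Ici fun z hz => ?_
    refine (hl_le z).trans (Real.exp_le_exp.mpr (neg_le_neg ?_))
    have hz' : 0 ≤ x + z := by rw [mem_Ici] at hz; linarith
    have := (hbd _ hz').2
    have := le_max_left z 0
    exact mul_le_mul_of_nonneg_left (by linarith) hγ.le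
  have h2 : ∫ z in Iio (-x), l z ∂ν ≤ (ν (Iio (-x))).toReal := by
    have : ∫ z in Iio (-x), l z ∂ν ≤ ∫ z in Iio (-x), (1 : ℝ) ∂ν := by
      refine integral_mono hl.integrableOn (integrable_const _) fun z => (hl_le z).trans ?_
      rw [Real.exp_le_one_iff]
      have := le_max_right z 0
      have : 0 ≤ γ * (x + max z 0 + b) := mul_nonneg hγ.le (by linarith)
      linarith
    simpa [Measure.real] using this
  have h3 : ∫ z in Ici (-x), l z ∂ν + ∫ z in Iio (-x), l z ∂ν = ∫ z, l z ∂ν := by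
    rw [← compl_Ici]
    exact integral_add_compl measurableSet_Ici hl
  have hF : Real.exp (-(γ * c)) ≤ (∫ z in Ici (-x), Real.exp (-(γ * J (x + z))) ∂ν)
      + (ν (Iio (-x))).toReal := by linarith
  have hlog := (Real.le_log_iff_exp_le ((Real.exp_pos _).trans_le hF)).mpr hF
  have := mul_le_mul_of_nonneg_left hlog (div_pos hβ0 hγ).le
  have he : β / γ * -(γ * c) = -(β * c) := by field_simp
  rw [he] at this
  unfold Gam
  linarith

/-- if `a = 0` attains the supremum at `x`, i.e. `J(x) = Γ(x)`,
then `x ≤ b̄/(1-β)`; consequently the set of points where `0` is the greatest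
maximizer is bounded above (its supremum `ξ` is finite). -/
theorem zero_maximizer_bound (ν : Measure ℝ) [IsProbabilityMeasure ν]
    (hac : ν ≪ volume) (hint : Integrable (fun z => max z 0) ν)
    (hneg : 0 < ν (Iio 0)) (β γ : ℝ) (hβ : β ∈ Ioo (0:ℝ) 1) (hγ : 0 < γ)
    (J : ℝ → ℝ) (hJ : memS ν β J) (hfix : Tdiv ν β γ J = J) :
    (∀ x : ℝ, 0 ≤ x → J x = Gam ν β γ J x → x ≤ bbar ν β / (1 - β)) ∧
    BddAbove {x : ℝ | 0 ≤ x ∧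
      IsGreatest {a | a ∈ Icc 0 x ∧ a + Gam ν β γ J (x - a) = J x} 0} := by
  have key : ∀ x : ℝ, 0 ≤ x → J x = Gam ν β γ J x → x ≤ bbar ν β / (1 - β) := by
    intro x hx hEq
    have h1 : 0 < 1 - β := by linarith [hβ.2]
    have hG := Gam_le ν hint hβ hγ hJ hx
    have hxJ := (hJ.2.1 x hx).1
    have hb : bbar ν β * (1 - β) = β * ∫ z, max z 0 ∂ν := div_mul_cancel₀ _ h1.ne'
    rw [le_div_iff₀ h1]
    linarith
  refine ⟨key, bbar ν β / (1 - β), ?_⟩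
  rintro x ⟨hx, ⟨-, h0⟩, -⟩
  refine key x hx ?_
  simpa using h0.symm
end

section
/- For all 0 ≤ y < x, if α*(x) ≥ x − y, then α*(x) = α*(y) + x − y. (This is the key structural fact from which it follows that the stationary policy given by α* is a band policy.) -/
open MeasureTheory Set Filter Topology

/-- Every admissible dividend `a ∈ [0, x]` is dominated by the value function. The supremum defining
`Tdiv` is over a bounded set for `x > 0`, since its junk value `0` contradicts `x ≤ J x`. -/
theorem add_Gam_le_of_Tdiv_eq {ν : Measure ℝ} {β γ : ℝ} {J : ℝ → ℝ} (hJ : ∀ x, 0 ≤ x → x ≤ J x)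
    (hfix : Tdiv ν β γ J = J) {x a : ℝ} (ha : a ∈ Icc 0 x) :
    a + Gam ν β γ J (x - a) ≤ J x := by
  have hx : 0 ≤ x := ha.1.trans ha.2
  have hsup : J x = sSup ((fun a => a + Gam ν β γ J (x - a)) '' Icc 0 x) := by
    conv_lhs => rw [← hfix]
    simp only [Tdiv, if_pos hx, Gam, neg_sub, neg_mul, ← sub_eq_add_neg]
  have hbdd : BddAbove ((fun a => a + Gam ν β γ J (x - a)) '' Icc 0 x) := by
    rcases hx.eq_or_lt with rfl | hpos
    · simp
    · by_contra h
      have hzero := hsup.trans (Real.sSup_of_not_bddAbove h)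
      linarith [hJ x hx]
  rw [hsup]
  exact le_csSup hbdd ⟨a, ha, rfl⟩

/-- the key band-structure fact: if `0 ≤ y < x` and
`α*(x) ≥ x - y`, then `α*(x) = α*(y) + x - y`. -/
theorem band_structure_key (ν : Measure ℝ) [IsProbabilityMeasure ν]
    (hac : ν ≪ volume) (hint : Integrable (fun z => max z 0) ν)
    (hneg : 0 < ν (Iio 0)) (β γ : ℝ) (hβ : β ∈ Ioo (0:ℝ) 1) (hγ : 0 < γ)
    (J : ℝ → ℝ) (hJ : memS ν β J) (hfix : Tdiv ν β γ J = J)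
    (αs : ℝ → ℝ)
    (hαs : ∀ x : ℝ, 0 ≤ x →
      IsGreatest {a | a ∈ Icc 0 x ∧ a + Gam ν β γ J (x - a) = J x} (αs x)) :
    ∀ x y : ℝ, 0 ≤ y → y < x → x - y ≤ αs x → αs x = αs y + x - y := by
  intro x y hy hyx hle
  have hx : 0 ≤ x := hy.trans hyx.le
  obtain ⟨⟨⟨hx0, hxx⟩, hxJ⟩, hxmax⟩ := hαs x hx
  obtain ⟨⟨⟨hy0, hyy⟩, hyJ⟩, hymax⟩ := hαs y hy
  have hle_J {u a : ℝ} (ha : a ∈ Icc 0 u) : a + Gam ν β γ J (u - a) ≤ J u :=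
    add_Gam_le_of_Tdiv_eq (fun w hw => (hJ.2.1 w hw).1) hfix ha
  have hmem_y : αs x - (x - y) ∈ Icc 0 y := ⟨by linarith, by linarith⟩
  have hmem_x : αs y + x - y ∈ Icc 0 x := ⟨by linarith, by linarith⟩
  have hy_le := hle_J hmem_y
  have hx_le := hle_J hmem_x
  have hsub_y : y - (αs x - (x - y)) = x - αs x := by ring
  have hsub_x : x - (αs y + x - y) = y - αs y := by ring
  rw [hsub_y] at hy_le
  rw [hsub_x] at hx_le
  have h₁ : αs x - (x - y) ≤ αs y := hymax ⟨hmem_y, by rw [hsub_y]; linarith⟩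
  have h₂ : αs y + x - y ≤ αs x := hxmax ⟨hmem_x, by rw [hsub_x]; linarith⟩
  linarith
end
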